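/- Let D ≥ 1, R ≥ 1, M₁ ≥ 1, and 1 ≤ R₀ ≤ R be integers, and let ι_1, …, ι_R be spatial multi-indices with Σ_{r=1}^R |ι_r| = M₁ and |ι_r| ≤ M₁ − 1 for r = R − R₀ + 1, …, R. There exists a constant C = C(D, M₁, R) > 0 such that for all smooth functions v_1, …, v_R : 𝕋^D → ℝ: ‖∂^{ι_1} v_1 ⋯ ∂^{ι_R} v_R‖_{L²} ≤ C [ Σ_{r=1}^{R−R₀} (‖v_r‖_{W^{1,∞}} + ‖v_r‖_{Ḣ^{M₁}}) ∏_{s ≠ r} ‖v_s‖_{W^{1,∞}} + Σ_{r=R−R₀+1}^{R} (‖v_r‖_{W^{1,∞}} + ‖v_r‖_{Ḣ^{M₁−1}}) ∏_{s ≠ r} ‖v_s‖_{W^{1,∞}} ]. (Paper's Lemma 4.1, product inequality (4.4).) -/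

import Mathlib

noncomputable section

open MeasureTheory

/-- `v` is `ℤ^D`-periodic: models a function on the torus `𝕋^D = (ℝ/ℤ)^D`. -/
def TorusFun (D : ℕ) (v : (Fin D → ℝ) → ℝ) : Prop :=
  ∀ (x : Fin D → ℝ) (i : Fin D), v (x + Pi.single i 1) = v x

/-- Coordinate partial derivative `∂_i v`. -/
def pd {D : ℕ} (i : Fin D) (v : (Fin D → ℝ) → ℝ) : (Fin D → ℝ) → ℝ :=
  fun x => fderiv ℝ v x (Pi.single i 1)

/-- Iterated coordinate derivative `∂^ι v` for a spatial multi-index `ι`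
(encoded as a list of coordinate directions; `|ι|` is the length of the list). -/
def pdIter {D : ℕ} : List (Fin D) → ((Fin D → ℝ) → ℝ) → ((Fin D → ℝ) → ℝ)
  | [], v => v
  | i :: l, v => pd i (pdIter l v)

/-- The fundamental domain `[0,1]^D` of `𝕋^D`. -/
def cube (D : ℕ) : Set (Fin D → ℝ) := Set.univ.pi fun _ => Set.Icc (0 : ℝ) 1

/-- Squared `L²(𝕋^D)` norm. -/
def L2sq {D : ℕ} (v : (Fin D → ℝ) → ℝ) : ℝ := ∫ x in cube D, (v x) ^ 2

/-- `L²(𝕋^D)` norm. -/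
def L2norm {D : ℕ} (v : (Fin D → ℝ) → ℝ) : ℝ := Real.sqrt (L2sq v)

/-- Homogeneous Sobolev seminorm `‖v‖_{Ḣ^M}`: the sum ranges over all ordered
spatial multi-indices of length `M`, encoded as functions `Fin M → Fin D`. -/
def HdotNorm {D : ℕ} (M : ℕ) (v : (Fin D → ℝ) → ℝ) : ℝ :=
  Real.sqrt (∑ ι : Fin M → Fin D, L2sq (pdIter (List.ofFn ι) v))

/-- Inhomogeneous Sobolev norm `‖v‖_{H^M}` (sum over all multi-indices `|ι| ≤ M`). -/
def HNorm {D : ℕ} (M : ℕ) (v : (Fin D → ℝ) → ℝ) : ℝ :=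
  Real.sqrt (∑ m ∈ Finset.range (M + 1), ∑ ι : Fin m → Fin D, L2sq (pdIter (List.ofFn ι) v))

/-- `L^∞(𝕋^D)` norm. -/
def LinfNorm {D : ℕ} (v : (Fin D → ℝ) → ℝ) : ℝ := ⨆ x, |v x|

/-- `W^{M,∞}(𝕋^D)` norm (sum over all multi-indices `|ι| ≤ M`). -/
def WinfNorm {D : ℕ} (M : ℕ) (v : (Fin D → ℝ) → ℝ) : ℝ :=
  ∑ m ∈ Finset.range (M + 1), ∑ ι : Fin m → Fin D, LinfNorm (pdIter (List.ofFn ι) v)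

section LogConvexity

lemma pow_succ_le_of_sq_le_mul {C : ℝ} (hC : 0 ≤ C) (j : ℕ) :
    ∃ K : ℝ, 0 ≤ K ∧ ∀ a : ℕ → ℝ, (∀ i, 0 ≤ a i) →
      (∀ i, i + 1 ≤ j → a (i + 1) ^ 2 ≤ C * a i * a (i + 2)) →
        a j ^ (j + 1) ≤ K * a 0 * a (j + 1) ^ j := by
  induction j with
  | zero => exact ⟨1, zero_le_one, fun a _ _ => by simp⟩
  | succ j ih =>
    obtain ⟨K, hK, h⟩ := ih
    refine ⟨C ^ (j + 1) * K, by positivity, fun a ha hc => ?_⟩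
    have h1 := h a ha fun i hi => hc i (by omega)
    have h2 := hc j le_rfl
    rcases (ha (j + 1)).eq_or_lt with h0 | h0
    · rw [← h0, zero_pow (by omega)]
      have := ha 0
      have := ha (j + 1 + 1)
      positivity
    · refine le_of_mul_le_mul_right ?_ (pow_pos h0 j)
      calc a (j + 1) ^ (j + 1 + 1) * a (j + 1) ^ j = (a (j + 1) ^ 2) ^ (j + 1) := by ring
        _ ≤ (C * a j * a (j + 2)) ^ (j + 1) := pow_le_pow_left₀ (by positivity) h2 _
        _ = C ^ (j + 1) * a (j + 2) ^ (j + 1) * a j ^ (j + 1) := by ring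
        _ ≤ C ^ (j + 1) * a (j + 2) ^ (j + 1) * (K * a 0 * a (j + 1) ^ j) :=
          mul_le_mul_of_nonneg_left h1 (by have := ha (j + 2); positivity)
        _ = C ^ (j + 1) * K * a 0 * a (j + 1 + 1) ^ (j + 1) * a (j + 1) ^ j := by ring

/-- A sequence that is log-convex up to a multiplicative constant interpolates between
its end points. -/
lemma pow_le_of_sq_le_mul {C : ℝ} (hC : 0 ≤ C) (j d : ℕ) :
    ∃ K : ℝ, 0 ≤ K ∧ ∀ a : ℕ → ℝ, (∀ i, 0 ≤ a i) →
      (∀ i, i + 2 ≤ j + d → a (i + 1) ^ 2 ≤ C * a i * a (i + 2)) →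
        a j ^ (j + d) ≤ K * a 0 ^ d * a (j + d) ^ j := by
  induction d with
  | zero => exact ⟨1, zero_le_one, fun a _ _ => by simp⟩
  | succ d ih =>
    obtain ⟨K, hK, h⟩ := ih
    rcases Nat.eq_zero_or_pos (j + d) with hn | hn
    · obtain ⟨rfl, rfl⟩ : j = 0 ∧ d = 0 := by omega
      exact ⟨1, zero_le_one, fun a _ _ => by simp⟩
    obtain ⟨L, hL, h'⟩ := pow_succ_le_of_sq_le_mul hC (j + d)
    set n := j + d with hnd
    refine ⟨max 1 (K ^ (n + 1) * L ^ j), by positivity, fun a ha hc => ?_⟩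
    have h1 := h a ha fun i hi => hc i (by omega)
    have h2 := h' a ha fun i hi => hc i (by omega)
    have ha0 := ha 0
    have haj := ha j
    have han := ha n
    have han' := ha (n + 1)
    have hM : (1 : ℝ) ≤ max 1 (K ^ (n + 1) * L ^ j) := le_max_left _ _
    rw [show j + (d + 1) = n + 1 by omega]
    refine le_of_pow_le_pow_left₀ hn.ne' (by positivity) ?_
    calc (a j ^ (n + 1)) ^ n = (a j ^ n) ^ (n + 1) := by ring
      _ ≤ (K * a 0 ^ d * a n ^ j) ^ (n + 1) := pow_le_pow_left₀ (by positivity) h1 _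
      _ = K ^ (n + 1) * a 0 ^ (d * (n + 1)) * (a n ^ (n + 1)) ^ j := by
        rw [mul_pow, mul_pow, ← pow_mul, ← pow_mul, ← pow_mul, mul_comm j]
      _ ≤ K ^ (n + 1) * a 0 ^ (d * (n + 1)) * (L * a 0 * a (n + 1) ^ n) ^ j := by gcongr
      _ = K ^ (n + 1) * L ^ j * a 0 ^ (d * (n + 1) + j) * a (n + 1) ^ (n * j) := by ring
      _ = K ^ (n + 1) * L ^ j * (a 0 ^ ((d + 1) * n) * a (n + 1) ^ (n * j)) := by
        rw [show d * (n + 1) + j = (d + 1) * n by rw [hnd]; ring]; ring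
      _ ≤ max 1 (K ^ (n + 1) * L ^ j) ^ n * (a 0 ^ ((d + 1) * n) * a (n + 1) ^ (n * j)) := by
        gcongr
        exact (le_max_right _ _).trans (le_self_pow₀ hM hn.ne')
      _ = (max 1 (K ^ (n + 1) * L ^ j) * a 0 ^ (d + 1) * a (n + 1) ^ j) ^ n := by
        rw [mul_pow, mul_pow, ← pow_mul, ← pow_mul, mul_comm j]; ring

end LogConvexity

lemma hasDerivAt_abs_rpow_mul_self {q : ℝ} (hq : 0 < q) (x : ℝ) :
    HasDerivAt (fun y : ℝ => |y| ^ q * y) ((q + 1) * |x| ^ q) x := by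
  rcases eq_or_ne x 0 with rfl | hx
  · rw [abs_zero, Real.zero_rpow hq.ne', mul_zero, hasDerivAt_iff_tendsto_slope]
    have h : Filter.Tendsto (fun y : ℝ => |y| ^ q) (nhdsWithin 0 {0}ᶜ) (nhds 0) := by
      have : Continuous fun y : ℝ => |y| ^ q :=
        (Real.continuous_rpow_const hq.le).comp continuous_abs
      simpa [Real.zero_rpow hq.ne'] using (this.tendsto 0).mono_left nhdsWithin_le_nhds
    refine h.congr' ?_
    filter_upwards [self_mem_nhdsWithin] with y hy
    have hy : y ≠ 0 := hy
    simp [slope_def_field, hy]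
  · have h := ((hasDerivAt_abs hx).rpow_const (p := q) (Or.inl (abs_ne_zero.2 hx))).mul
      (hasDerivAt_id x)
    refine h.congr_deriv ?_
    have h1 : |x| ^ (q - 1) * |x| = |x| ^ q := by
      rw [← Real.rpow_add_one (abs_ne_zero.2 hx)]; ring_nf
    have h2 : (SignType.sign x : ℝ) * x = |x| := by
      rw [mul_comm, self_mul_sign]
    simp only [id]
    calc _ = q * (|x| ^ (q - 1) * ((SignType.sign x : ℝ) * x)) + |x| ^ q := by ring
      _ = _ := by rw [h2, h1]; ring

section Torus

variable {D : ℕ}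

lemma isCompact_cube : IsCompact (cube D) := isCompact_univ_pi fun _ => isCompact_Icc

instance isProbabilityMeasure_restrict_cube :
    IsProbabilityMeasure ((volume : Measure (Fin D → ℝ)).restrict (cube D)) := by
  constructor
  rw [Measure.restrict_apply_univ, cube, volume_pi_pi]
  simp

lemma Continuous.integrableOn_cube {f : (Fin D → ℝ) → ℝ} (hf : Continuous f) :
    IntegrableOn f (cube D) := hf.continuousOn.integrableOn_compact isCompact_cube

lemma TorusFun.add_single_int {v : (Fin D → ℝ) → ℝ} (hv : TorusFun D v) (i : Fin D) (n : ℤ)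
    (x : Fin D → ℝ) : v (x + Pi.single i (n : ℝ)) = v x := by
  induction n using Int.induction_on generalizing x with
  | zero => simp
  | succ n ih =>
    have h : x + Pi.single i ((((n : ℤ) + 1 : ℤ)) : ℝ) = (x + Pi.single i ((n : ℤ) : ℝ))
        + Pi.single i 1 := by
      rw [add_assoc, ← Pi.single_add]; push_cast; rfl
    rw [h, hv, ih]
  | pred n ih =>
    have h : (x + Pi.single i (((-(n : ℤ) - 1 : ℤ)) : ℝ)) + Pi.single i 1
        = x + Pi.single i ((-(n : ℤ) : ℤ) : ℝ) := by
      rw [add_assoc, ← Pi.single_add]; push_cast; ring_nf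
    rw [← hv, h, ih]

lemma TorusFun.exists_mem_cube {v : (Fin D → ℝ) → ℝ} (hv : TorusFun D v) (x : Fin D → ℝ) :
    ∃ y ∈ cube D, v y = v x := by
  have key : ∀ s : Finset (Fin D), ∃ y : Fin D → ℝ,
      (∀ i ∈ s, y i ∈ Set.Icc (0 : ℝ) 1) ∧ v y = v x := by
    intro s
    induction s using Finset.induction_on with
    | empty => exact ⟨x, by simp, rfl⟩
    | insert i s hi ih =>
      obtain ⟨y, hy, hyv⟩ := ih
      refine ⟨y + Pi.single i ((-⌊y i⌋ : ℤ) : ℝ), fun j hj => ?_, ?_⟩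
      · rcases eq_or_ne j i with rfl | hji
        · have h1 := Int.floor_le (y j)
          have h2 := Int.lt_floor_add_one (y j)
          simp only [Pi.add_apply, Pi.single_eq_same, Set.mem_Icc]
          push_cast
          constructor <;> linarith
        · simpa [Pi.single_eq_of_ne hji] using hy j (Finset.mem_of_mem_insert_of_ne hj hji)
      · rw [hv.add_single_int, hyv]
  obtain ⟨y, hy, hyv⟩ := key Finset.univ
  exact ⟨y, fun i _ => hy i (Finset.mem_univ i), hyv⟩

lemma TorusFun.bddAbove_abs {v : (Fin D → ℝ) → ℝ} (hv : TorusFun D v) (hc : Continuous v) :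
    BddAbove (Set.range fun x => |v x|) := by
  obtain ⟨B, hB⟩ := (isCompact_cube (D := D)).bddAbove_image hc.abs.continuousOn
  refine ⟨B, ?_⟩
  rintro _ ⟨x, rfl⟩
  obtain ⟨y, hy, hyx⟩ := hv.exists_mem_cube x
  exact hB ⟨y, hy, by simp [hyx]⟩

lemma TorusFun.abs_le_linfNorm {v : (Fin D → ℝ) → ℝ} (hv : TorusFun D v) (hc : Continuous v)
    (x : Fin D → ℝ) : |v x| ≤ LinfNorm v :=
  le_ciSup (hv.bddAbove_abs hc) x

lemma linfNorm_nonneg (v : (Fin D → ℝ) → ℝ) : 0 ≤ LinfNorm v :=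
  Real.iSup_nonneg fun _ => abs_nonneg _

lemma TorusFun.pd {v : (Fin D → ℝ) → ℝ} (hv : TorusFun D v) (i : Fin D) :
    TorusFun D (pd i v) := by
  intro x j
  have h : (fun y => v (y + Pi.single j 1)) = v := funext fun y => hv y j
  unfold _root_.pd
  rw [← fderiv_comp_add_right, h]

lemma ContDiff.pd {v : (Fin D → ℝ) → ℝ} (hv : ContDiff ℝ (⊤ : ℕ∞) v) (i : Fin D) :
    ContDiff ℝ (⊤ : ℕ∞) (pd i v) :=
  (hv.fderiv_right (m := (⊤ : ℕ∞)) (by simp)).clm_apply contDiff_const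

lemma TorusFun.pdIter {v : (Fin D → ℝ) → ℝ} (hv : TorusFun D v) (l : List (Fin D)) :
    TorusFun D (pdIter l v) := by
  induction l with
  | nil => exact hv
  | cons i l ih => exact ih.pd i

lemma ContDiff.pdIter {v : (Fin D → ℝ) → ℝ} (hv : ContDiff ℝ (⊤ : ℕ∞) v) (l : List (Fin D)) :
    ContDiff ℝ (⊤ : ℕ∞) (pdIter l v) := by
  induction l with
  | nil => exact hv
  | cons i l ih => exact ih.pd i

lemma pdIter_zero (l : List (Fin D)) : pdIter l (fun _ => (0 : ℝ)) = fun _ => 0 := by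
  induction l with
  | nil => rfl
  | cons i l ih =>
    funext x
    simp [pdIter, pd, ih]

/-- The integral of a coordinate derivative over the torus vanishes. -/
lemma TorusFun.integral_fderiv_eq_zero {F : (Fin D → ℝ) → ℝ} (hF : TorusFun D F)
    {F' : (Fin D → ℝ) → (Fin D → ℝ) →L[ℝ] ℝ} (hd : ∀ x, HasFDerivAt F (F' x) x) (i : Fin D)
    (hc : Continuous fun x => F' x (Pi.single i 1)) :
    ∫ x in cube D, F' x (Pi.single i 1) = 0 := by
  obtain ⟨n, rfl⟩ : ∃ n, D = n + 1 := ⟨D - 1, by have := i.pos; omega⟩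
  have hcube : cube (n + 1) = Set.Icc (0 : Fin (n + 1) → ℝ) 1 := by
    rw [← Set.pi_univ_Icc]; rfl
  have hFc : Continuous F := continuous_iff_continuousAt.2 fun x => (hd x).continuousAt
  have hsum : ∀ x, ∑ j, (if j = i then F' x else 0) (Pi.single j 1) = F' x (Pi.single i 1) := by
    intro x
    rw [Finset.sum_eq_single i]
    · simp
    · intro j _ hj; simp [hj]
    · simp
  have h := integral_divergence_of_hasFDerivAt_off_countable' (0 : Fin (n + 1) → ℝ) 1
    (fun _ => zero_le_one) (fun j => if j = i then F else 0)
    (fun j x => if j = i then F' x else 0) ∅ Set.countable_empty ?_ ?_ ?_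
  · simp only [hsum] at h
    rw [hcube, h]
    refine Finset.sum_eq_zero fun j _ => ?_
    rcases eq_or_ne j i with rfl | hj
    · rw [sub_eq_zero]
      congr 1
      funext x
      have : (j.insertNth ((1 : Fin (n + 1) → ℝ) j) x : Fin (n + 1) → ℝ)
          = j.insertNth ((0 : Fin (n + 1) → ℝ) j) x + Pi.single j 1 := by
        funext k
        refine Fin.succAboveCases j ?_ (fun k => ?_) k
        · simp
        · simp
      simp only [if_true]
      rw [this, hF]
    · simp [hj]
  · intro j
    split_ifs
    · exact hFc.continuousOn
    · exact continuousOn_const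
  · intro x _ j
    split_ifs
    · exact hd x
    · exact hasFDerivAt_const _ _
  · simp only [hsum]
    exact hc.continuousOn.integrableOn_compact isCompact_Icc

end Torus

section Hoelder

lemma integral_prod_rpow_le {α ι : Type*} [MeasurableSpace α] [Fintype ι] {μ : Measure α}
    [IsProbabilityMeasure μ] {F : ι → α → ℝ} {w : ι → ℝ} (hF : ∀ i, Integrable (F i) μ)
    (hF0 : ∀ i x, 0 ≤ F i x) (hw : ∀ i, 0 ≤ w i) (hw1 : ∑ i, w i ≤ 1)
    (hprod : Integrable (fun x => ∏ i, F i x ^ w i) μ) :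
    ∫ x, ∏ i, F i x ^ w i ∂μ ≤ ∏ i, (∫ x, F i x ∂μ) ^ w i := by
  have hI : ∀ i, 0 ≤ ∫ x, F i x ∂μ := fun i => integral_nonneg (hF0 i)
  have hP : 0 ≤ ∏ i, (∫ x, F i x ∂μ) ^ w i :=
    Finset.prod_nonneg fun i _ => Real.rpow_nonneg (hI i) _
  have h0 : ∀ x, 0 ≤ ∏ i, F i x ^ w i := fun x =>
    Finset.prod_nonneg fun i _ => Real.rpow_nonneg (hF0 i x) _
  rw [← ENNReal.ofReal_le_ofReal_iff hP,
    ofReal_integral_eq_lintegral_ofReal hprod (Filter.Eventually.of_forall h0),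
    ENNReal.ofReal_prod_of_nonneg fun i _ => Real.rpow_nonneg (hI i) _]
  have h := ENNReal.lintegral_mul_prod_norm_pow_le (μ := μ) Finset.univ (g := fun _ => 1)
    (f := fun i x => ENNReal.ofReal (F i x)) aemeasurable_const
    (fun i _ => (hF i).aemeasurable.ennreal_ofReal) (1 - ∑ i, w i) (p := w) (by ring)
    (by linarith) fun i _ => hw i
  simp only [ENNReal.one_rpow, one_mul, lintegral_const, measure_univ] at h
  calc _ = ∫⁻ x, ∏ i, ENNReal.ofReal (F i x) ^ w i ∂μ := by
        refine lintegral_congr fun x => ?_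
        rw [ENNReal.ofReal_prod_of_nonneg fun i _ => Real.rpow_nonneg (hF0 i x) _]
        exact Finset.prod_congr rfl fun i _ =>
          (ENNReal.ofReal_rpow_of_nonneg (hF0 i x) (hw i)).symm
    _ ≤ _ := h
    _ = _ := Finset.prod_congr rfl fun i _ => by
        rw [← ENNReal.ofReal_rpow_of_nonneg (hI i) (hw i),
          ofReal_integral_eq_lintegral_ofReal (hF i) (Filter.Eventually.of_forall (hF0 i))]

variable {D : ℕ}

/-- The norm of `L^{1/s}(𝕋^D)`, where `s = 0` stands for `L^∞`. -/
def invLpNorm (s : ℝ) (f : (Fin D → ℝ) → ℝ) : ℝ :=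
  if s = 0 then LinfNorm f else (∫ x in cube D, |f x| ^ s⁻¹) ^ s

lemma invLpNorm_nonneg (s : ℝ) (f : (Fin D → ℝ) → ℝ) : 0 ≤ invLpNorm s f := by
  unfold invLpNorm
  split_ifs
  · exact linfNorm_nonneg f
  · exact Real.rpow_nonneg
      (integral_nonneg fun x => Real.rpow_nonneg (abs_nonneg _) _) _

lemma invLpNorm_half (f : (Fin D → ℝ) → ℝ) : invLpNorm (1 / 2) f = L2norm f := by
  rw [invLpNorm, if_neg (by norm_num), L2norm, L2sq, Real.sqrt_eq_rpow]
  norm_num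

/-- Hölder's inequality for finitely many powers on the torus. -/
lemma integral_prod_abs_rpow_le {ι : Type*} [Fintype ι] {f : ι → (Fin D → ℝ) → ℝ}
    (hf : ∀ i, Continuous (f i)) (hper : ∀ i, TorusFun D (f i)) {e s : ι → ℝ}
    (he : ∀ i, 0 ≤ e i) (hs : ∀ i, 0 ≤ s i) (hes : ∑ i, e i * s i ≤ 1) :
    ∫ x in cube D, ∏ i, |f i x| ^ e i ≤ ∏ i, invLpNorm (s i) (f i) ^ e i := by
  set F : ι → (Fin D → ℝ) → ℝ := fun i x => |f i x| ^ (s i)⁻¹ with hFdef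
  set c : ι → ℝ := fun i => if s i = 0 then LinfNorm (f i) ^ e i else 1 with hcdef
  have hF0 : ∀ i x, 0 ≤ F i x := fun i x => Real.rpow_nonneg (abs_nonneg _) _
  have hFc : ∀ i, Continuous (F i) := fun i =>
    (Real.continuous_rpow_const (inv_nonneg.2 (hs i))).comp (hf i).abs
  have hw : ∀ i, 0 ≤ e i * s i := fun i => mul_nonneg (he i) (hs i)
  have hprod : Continuous fun x => ∏ i, F i x ^ (e i * s i) :=
    continuous_finsetProd _ fun i _ => (Real.continuous_rpow_const (hw i)).comp (hFc i)
  have hpt : ∀ i x, |f i x| ^ e i ≤ c i * F i x ^ (e i * s i) := by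
    intro i x
    simp only [hFdef, hcdef]
    split_ifs with h
    · rw [h, mul_zero, Real.rpow_zero, mul_one]
      exact Real.rpow_le_rpow (abs_nonneg _) ((hper i).abs_le_linfNorm (hf i) x) (he i)
    · rw [← Real.rpow_mul (abs_nonneg _), one_mul, mul_comm (e i), inv_mul_cancel_left₀ h]
  calc ∫ x in cube D, ∏ i, |f i x| ^ e i
      ≤ ∫ x in cube D, (∏ i, c i) * ∏ i, F i x ^ (e i * s i) := by
        refine integral_mono ?_ ?_ fun x => ?_
        · exact (continuous_finsetProd _ fun i _ =>
            (Real.continuous_rpow_const (he i)).comp (hf i).abs).integrableOn_cube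
        · exact (continuous_const.mul hprod).integrableOn_cube
        · simp only [← Finset.prod_mul_distrib]
          exact Finset.prod_le_prod (fun i _ => Real.rpow_nonneg (abs_nonneg _) _)
            fun i _ => hpt i x
    _ = (∏ i, c i) * ∫ x in cube D, ∏ i, F i x ^ (e i * s i) := integral_const_mul _ _
    _ ≤ (∏ i, c i) * ∏ i, (∫ x in cube D, F i x) ^ (e i * s i) := by
        refine mul_le_mul_of_nonneg_left
          (integral_prod_rpow_le (fun i => (hFc i).integrableOn_cube) hF0 hw hes
            hprod.integrableOn_cube) (Finset.prod_nonneg fun i _ => ?_)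
        simp only [hcdef]
        split_ifs
        · exact Real.rpow_nonneg (linfNorm_nonneg _) _
        · exact zero_le_one
    _ = ∏ i, invLpNorm (s i) (f i) ^ e i := by
        rw [← Finset.prod_mul_distrib]
        refine Finset.prod_congr rfl fun i _ => ?_
        simp only [hcdef, invLpNorm]
        split_ifs with h
        · simp [h]
        · rw [one_mul, mul_comm, Real.rpow_mul (integral_nonneg (hF0 i))]

lemma l2Norm_prod_le {ι : Type*} [Fintype ι] {f : ι → (Fin D → ℝ) → ℝ}
    (hf : ∀ i, Continuous (f i)) (hper : ∀ i, TorusFun D (f i)) {s : ι → ℝ}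
    (hs : ∀ i, 0 ≤ s i) (hs1 : ∑ i, 2 * s i ≤ 1) :
    L2norm (fun x => ∏ i, f i x) ≤ ∏ i, invLpNorm (s i) (f i) := by
  have h := integral_prod_abs_rpow_le hf hper (e := fun _ => 2) (fun _ => zero_le_two) hs hs1
  simp only [Real.rpow_ofNat, sq_abs, Finset.prod_pow] at h
  exact Real.sqrt_le_iff.2 ⟨Finset.prod_nonneg fun i _ => invLpNorm_nonneg _ _, h⟩

end Hoelder

section Interpolation

variable {D : ℕ}

/-- Integration by parts against `|∂g|^q ∂g`. -/
lemma integral_abs_rpow_pd {g : (Fin D → ℝ) → ℝ} (hg : ContDiff ℝ (⊤ : ℕ∞) g)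
    (hper : TorusFun D g) (i : Fin D) {q : ℝ} (hq : 0 < q) :
    ∫ x in cube D, |pd i g x| ^ (q + 2) =
      -∫ x in cube D, (q + 1) * (g x * |pd i g x| ^ q * pd i (pd i g) x) := by
  have hf := hg.pd i
  have hh := hf.pd i
  set f := pd i g with hfdef
  have hgd : ∀ x, HasFDerivAt g (fderiv ℝ g x) x := fun x =>
    (hg.differentiable (by simp) x).hasFDerivAt
  have hfd : ∀ x, HasFDerivAt f (fderiv ℝ f x) x := fun x =>
    (hf.differentiable (by simp) x).hasFDerivAt
  have hF : ∀ x, HasFDerivAt (fun y => g y * (|f y| ^ q * f y))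
      (g x • (((q + 1) * |f x| ^ q) • fderiv ℝ f x) + (|f x| ^ q * f x) • fderiv ℝ g x) x :=
    fun x => (hgd x).mul ((hasDerivAt_abs_rpow_mul_self hq (f x)).comp_hasFDerivAt x (hfd x))
  have hper' : TorusFun D fun y => g y * (|f y| ^ q * f y) := by
    intro x j
    simp only [hper x j, hper.pd i x j, hfdef]
  have hrw : ∀ x, (g x • (((q + 1) * |f x| ^ q) • fderiv ℝ f x) +
      (|f x| ^ q * f x) • fderiv ℝ g x) (Pi.single i 1) =
      (q + 1) * (g x * |f x| ^ q * pd i f x) + |f x| ^ (q + 2) := by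
    intro x
    have : |f x| ^ (q + 2) = |f x| ^ q * f x * f x := by
      rw [Real.rpow_add' (abs_nonneg _) (by linarith), Real.rpow_ofNat, sq_abs]; ring
    rw [this]
    simp only [add_apply, smul_apply, smul_eq_mul]
    change g x * ((q + 1) * |f x| ^ q * pd i f x) + |f x| ^ q * f x * f x = _
    ring
  have hc1 : Continuous fun x => (q + 1) * (g x * |f x| ^ q * pd i f x) :=
    continuous_const.mul ((hg.continuous.mul
      ((Real.continuous_rpow_const hq.le).comp hf.continuous.abs)).mul hh.continuous)
  have hc2 : Continuous fun x => |f x| ^ (q + 2) :=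
    (Real.continuous_rpow_const (by linarith)).comp hf.continuous.abs
  have h := hper'.integral_fderiv_eq_zero hF i (by simp only [hrw]; exact hc1.add hc2)
  simp only [hrw] at h
  rw [integral_add hc1.integrableOn_cube hc2.integrableOn_cube] at h
  linarith

lemma invLpNorm_pd_sq_le {g : (Fin D → ℝ) → ℝ} (hg : ContDiff ℝ (⊤ : ℕ∞) g)
    (hper : TorusFun D g) (i : Fin D) {s₁ s s₂ : ℝ} (hs₁ : 0 ≤ s₁) (hs₂ : 0 ≤ s₂) (hs : 0 < s)
    (hs' : s < 1 / 2) (hsum : s₁ + s₂ = 2 * s) :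
    invLpNorm s (pd i g) ^ 2 ≤
      (s⁻¹ - 1) * (invLpNorm s₁ g * invLpNorm s₂ (pd i (pd i g))) := by
  have hf := hg.pd i
  have hh := hf.pd i
  have hq : 0 < s⁻¹ - 2 := by
    have : (1 / 2)⁻¹ < s⁻¹ := inv_strictAnti₀ hs hs'
    norm_num at this
    linarith
  have hibp := integral_abs_rpow_pd hg hper i hq
  set f := pd i g with hfdef
  set h := pd i f with hhdef
  set q := s⁻¹ - 2 with hqdef
  have hfc : Continuous fun x => |f x| ^ q :=
    (Real.continuous_rpow_const hq.le).comp hf.continuous.abs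
  have hq2 : q + 2 = s⁻¹ := by rw [hqdef]; ring
  have hq1 : q + 1 = s⁻¹ - 1 := by rw [hqdef]; ring
  have hN0 := invLpNorm_nonneg s f
  have hNpow : ∫ x in cube D, |f x| ^ (q + 2) = invLpNorm s f ^ (q + 2) := by
    rw [hq2, invLpNorm, if_neg hs.ne', Real.rpow_rpow_inv _ hs.ne']
    exact integral_nonneg fun x => Real.rpow_nonneg (abs_nonneg _) _
  have hHol := integral_prod_abs_rpow_le (ι := Fin 3) (f := ![g, f, h]) (e := ![1, q, 1])
    (s := ![s₁, s, s₂])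
    (by intro j; fin_cases j; exacts [hg.continuous, hf.continuous, hh.continuous])
    (by intro j; fin_cases j; exacts [hper, hper.pd i, (hper.pd i).pd i])
    (by intro j; fin_cases j; exacts [zero_le_one, hq.le, zero_le_one])
    (by intro j; fin_cases j; exacts [hs₁, hs.le, hs₂])
    (by
      simp only [Fin.sum_univ_three, Matrix.cons_val_zero, Matrix.cons_val_one,
        Matrix.cons_val]
      have : q * s = 1 - 2 * s := by rw [hqdef]; field_simp
      linarith)
  simp only [Fin.prod_univ_three, Matrix.cons_val_zero, Matrix.cons_val_one,
    Matrix.cons_val, Real.rpow_one] at hHol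
  have hbound : invLpNorm s f ^ (q + 2) ≤
      (q + 1) * (invLpNorm s₁ g * invLpNorm s f ^ q * invLpNorm s₂ h) := by
    rw [← hNpow, hibp]
    calc -∫ x in cube D, (q + 1) * (g x * |f x| ^ q * h x)
        ≤ |∫ x in cube D, (q + 1) * (g x * |f x| ^ q * h x)| := neg_le_abs _
      _ = (q + 1) * |∫ x in cube D, g x * |f x| ^ q * h x| := by
        rw [integral_const_mul, abs_mul, abs_of_pos (by linarith)]
      _ ≤ (q + 1) * ∫ x in cube D, |g x| * |f x| ^ q * |h x| := by
        refine mul_le_mul_of_nonneg_left ?_ (by linarith)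
        refine abs_integral_le_integral_abs.trans_eq (integral_congr_ae ?_)
        refine Filter.Eventually.of_forall fun x => ?_
        simp only [abs_mul, abs_of_nonneg (Real.rpow_nonneg (abs_nonneg (f x)) q)]
      _ ≤ _ := mul_le_mul_of_nonneg_left hHol (by linarith)
  rw [← hq1]
  rcases hN0.eq_or_lt with h0 | h0
  · rw [← h0, zero_pow two_ne_zero]
    have := invLpNorm_nonneg s₁ g
    have := invLpNorm_nonneg s₂ h
    have : 0 ≤ q + 1 := by linarith
    positivity
  · refine le_of_mul_le_mul_right ?_ (Real.rpow_pos_of_pos h0 q)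
    calc invLpNorm s f ^ 2 * invLpNorm s f ^ q = invLpNorm s f ^ (q + 2) := by
          rw [Real.rpow_add h0, Real.rpow_ofNat, mul_comm]
      _ ≤ _ := hbound
      _ = _ := by ring

/-- The sum of the `L^{1/s}` norms of all derivatives of order `k`. -/
def gradNorm (s : ℝ) (k : ℕ) (v : (Fin D → ℝ) → ℝ) : ℝ :=
  ∑ ι : Fin k → Fin D, invLpNorm s (pdIter (List.ofFn ι) v)

lemma gradNorm_nonneg (s : ℝ) (k : ℕ) (v : (Fin D → ℝ) → ℝ) : 0 ≤ gradNorm s k v :=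
  Finset.sum_nonneg fun _ _ => invLpNorm_nonneg _ _

lemma invLpNorm_pdIter_le_gradNorm (s : ℝ) (l : List (Fin D)) (v : (Fin D → ℝ) → ℝ) :
    invLpNorm s (pdIter l v) ≤ gradNorm s l.length v := by
  have h := Finset.single_le_sum (f := fun ι : Fin l.length → Fin D =>
    invLpNorm s (pdIter (List.ofFn ι) v)) (fun _ _ => invLpNorm_nonneg _ _)
    (Finset.mem_univ l.get)
  simp only [List.ofFn_get] at h
  exact h

lemma gradNorm_succ_sq_le {v : (Fin D → ℝ) → ℝ} (hv : ContDiff ℝ (⊤ : ℕ∞) v)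
    (hper : TorusFun D v) (k : ℕ) {s₁ s s₂ : ℝ} (hs₁ : 0 ≤ s₁) (hs₂ : 0 ≤ s₂) (hs : 0 < s)
    (hs' : s < 1 / 2) (hsum : s₁ + s₂ = 2 * s) :
    gradNorm s (k + 1) v ^ 2 ≤
      (D : ℝ) ^ (k + 1) * (D : ℝ) ^ (k + 1) * (s⁻¹ - 1) *
        (gradNorm s₁ k v * gradNorm s₂ (k + 2) v) := by
  have hs1 : 0 ≤ s⁻¹ - 1 := by
    have : (1 : ℝ)⁻¹ < s⁻¹ := inv_strictAnti₀ hs (by linarith)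
    norm_num at this
    linarith
  have hterm : ∀ ι : Fin (k + 1) → Fin D, invLpNorm s (pdIter (List.ofFn ι) v) ^ 2 ≤
      (s⁻¹ - 1) * (gradNorm s₁ k v * gradNorm s₂ (k + 2) v) := by
    intro ι
    rw [List.ofFn_succ]
    set l := List.ofFn fun i : Fin k => ι i.succ with hl
    have hlen : l.length = k := List.length_ofFn
    refine (invLpNorm_pd_sq_le (hv.pdIter l) (hper.pdIter l) (ι 0) hs₁ hs₂ hs hs' hsum).trans ?_
    refine mul_le_mul_of_nonneg_left (mul_le_mul ?_ ?_ (invLpNorm_nonneg _ _)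
      (gradNorm_nonneg _ _ _)) hs1
    · simpa only [hlen] using invLpNorm_pdIter_le_gradNorm s₁ l v
    · have h := invLpNorm_pdIter_le_gradNorm s₂ (ι 0 :: ι 0 :: l) v
      simp only [List.length_cons, hlen] at h
      exact h
  have hcard : ((Finset.univ : Finset (Fin (k + 1) → Fin D)).card : ℝ) = (D : ℝ) ^ (k + 1) := by
    simp
  calc gradNorm s (k + 1) v ^ 2
      ≤ (D : ℝ) ^ (k + 1) *
          ∑ ι : Fin (k + 1) → Fin D, invLpNorm s (pdIter (List.ofFn ι) v) ^ 2 := by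
        rw [← hcard]; exact sq_sum_le_card_mul_sum_sq
    _ ≤ (D : ℝ) ^ (k + 1) * ((D : ℝ) ^ (k + 1) *
          ((s⁻¹ - 1) * (gradNorm s₁ k v * gradNorm s₂ (k + 2) v))) := by
        refine mul_le_mul_of_nonneg_left ?_ (by positivity)
        rw [← hcard, ← nsmul_eq_mul]
        exact Finset.sum_le_card_nsmul _ _ _ fun ι _ => hterm ι
    _ = _ := by ring

lemma winfNorm_one_eq (v : (Fin D → ℝ) → ℝ) :
    WinfNorm 1 v = LinfNorm v + gradNorm 0 1 v := by
  simp [WinfNorm, gradNorm, invLpNorm, Finset.sum_range_succ, pdIter]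

lemma winfNorm_nonneg (M : ℕ) (v : (Fin D → ℝ) → ℝ) : 0 ≤ WinfNorm M v :=
  Finset.sum_nonneg fun _ _ => Finset.sum_nonneg fun _ _ => linfNorm_nonneg _

lemma hdotNorm_nonneg (M : ℕ) (v : (Fin D → ℝ) → ℝ) : 0 ≤ HdotNorm M v := Real.sqrt_nonneg _

lemma l2Norm_pdIter_ofFn_le {M : ℕ} (v : (Fin D → ℝ) → ℝ) (ι : Fin M → Fin D) :
    L2norm (pdIter (List.ofFn ι) v) ≤ HdotNorm M v :=
  Real.sqrt_le_sqrt <| Finset.single_le_sum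
    (f := fun ι : Fin M → Fin D => L2sq (pdIter (List.ofFn ι) v))
    (fun _ _ => integral_nonneg fun _ => sq_nonneg _) (Finset.mem_univ ι)

lemma gradNorm_half_le (M : ℕ) (v : (Fin D → ℝ) → ℝ) :
    gradNorm (1 / 2) M v ≤ (D : ℝ) ^ M * HdotNorm M v := by
  have h := Finset.sum_le_card_nsmul (Finset.univ : Finset (Fin M → Fin D))
    (fun ι => invLpNorm (1 / 2) (pdIter (List.ofFn ι) v)) (HdotNorm M v)
    fun ι _ => by rw [invLpNorm_half]; exact l2Norm_pdIter_ofFn_le v ι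
  simpa [gradNorm] using h

/-- Gagliardo–Nirenberg interpolation between `‖∇v‖_{L^∞}` and `‖∇^{n+1}v‖_{L²}`. -/
lemma exists_gradNorm_pow_le (D : ℕ) {n j : ℕ} (hn : 0 < n) (hj : j ≤ n) :
    ∃ K : ℝ, 0 ≤ K ∧ ∀ v : (Fin D → ℝ) → ℝ, ContDiff ℝ (⊤ : ℕ∞) v → TorusFun D v →
      gradNorm ((j : ℝ) / (2 * n)) (j + 1) v ^ n ≤
        K * (WinfNorm 1 v ^ (n - j) * HdotNorm (n + 1) v ^ j) := by
  have hn' : (0 : ℝ) < n := Nat.cast_pos.2 hn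
  obtain ⟨K, hK, h⟩ := pow_le_of_sq_le_mul
    (C := ((D : ℝ) + 1) ^ n * ((D : ℝ) + 1) ^ n * (2 * n)) (by positivity) j (n - j)
  refine ⟨K * ((D : ℝ) ^ (n + 1)) ^ j, by positivity, fun v hv hper => ?_⟩
  have h1 := h (fun i => gradNorm ((i : ℝ) / (2 * n)) (i + 1) v)
    (fun i => gradNorm_nonneg _ _ _) fun i hi => ?_
  · rw [Nat.add_sub_cancel' hj] at h1
    refine h1.trans ?_
    have h0 : gradNorm (((0 : ℕ) : ℝ) / (2 * n)) (0 + 1) v ≤ WinfNorm 1 v := by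
      rw [winfNorm_one_eq, Nat.cast_zero, zero_div]
      exact le_add_of_nonneg_left (linfNorm_nonneg v)
    have h2 : gradNorm ((n : ℝ) / (2 * n)) (n + 1) v ≤ (D : ℝ) ^ (n + 1) * HdotNorm (n + 1) v := by
      rw [show (n : ℝ) / (2 * n) = 1 / 2 by field_simp]
      exact gradNorm_half_le _ _
    have := winfNorm_nonneg 1 v
    calc K * gradNorm (((0 : ℕ) : ℝ) / (2 * n)) (0 + 1) v ^ (n - j) *
          gradNorm ((n : ℝ) / (2 * n)) (n + 1) v ^ j
        ≤ K * WinfNorm 1 v ^ (n - j) * ((D : ℝ) ^ (n + 1) * HdotNorm (n + 1) v) ^ j :=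
          mul_le_mul (mul_le_mul_of_nonneg_left
            (pow_le_pow_left₀ (gradNorm_nonneg _ _ _) h0 _) hK)
            (pow_le_pow_left₀ (gradNorm_nonneg _ _ _) h2 _)
            (pow_nonneg (gradNorm_nonneg _ _ _) _) (by positivity)
      _ = _ := by rw [mul_pow]; ring
  · have hin : (i : ℝ) + 2 ≤ n := by exact_mod_cast (by omega : i + 2 ≤ n)
    have hi0 : (0 : ℝ) ≤ i := Nat.cast_nonneg i
    have hs : 0 < ((i + 1 : ℕ) : ℝ) / (2 * n) := by positivity
    have hs' : ((i + 1 : ℕ) : ℝ) / (2 * n) < 1 / 2 := by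
      rw [div_lt_div_iff₀ (by positivity) two_pos]; push_cast; linarith
    have h2 := gradNorm_succ_sq_le hv hper (i + 1) (s₁ := (i : ℝ) / (2 * n))
      (s₂ := ((i + 2 : ℕ) : ℝ) / (2 * n)) (by positivity) (by positivity) hs hs'
      (by push_cast; field_simp; ring)
    have hinv : (((i + 1 : ℕ) : ℝ) / (2 * n))⁻¹ - 1 ≤ 2 * n := by
      rw [inv_div]
      have : 2 * (n : ℝ) / ((i + 1 : ℕ) : ℝ) ≤ 2 * n :=
        div_le_self (by positivity) (by push_cast; linarith)
      linarith
    have hinv0 : 0 ≤ (((i + 1 : ℕ) : ℝ) / (2 * n))⁻¹ - 1 := by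
      have : (1 : ℝ)⁻¹ < (((i + 1 : ℕ) : ℝ) / (2 * n))⁻¹ := inv_strictAnti₀ hs (by linarith)
      norm_num at this ⊢
      linarith
    have hD : (D : ℝ) ^ (i + 1 + 1) ≤ ((D : ℝ) + 1) ^ n :=
      (pow_le_pow_left₀ (by positivity) (by linarith) _).trans
        (pow_le_pow_right₀ (by linarith [(Nat.cast_nonneg D : (0 : ℝ) ≤ D)]) (by omega))
    have hg := mul_nonneg (gradNorm_nonneg ((i : ℝ) / (2 * n)) (i + 1) v)
      (gradNorm_nonneg (((i + 2 : ℕ) : ℝ) / (2 * n)) (i + 1 + 2) v)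
    rw [mul_assoc]
    refine h2.trans (mul_le_mul_of_nonneg_right ?_ hg)
    exact mul_le_mul (mul_le_mul hD hD (by positivity) (by positivity)) hinv hinv0 (by positivity)

lemma exists_invLpNorm_pdIter_le_of_length_eq (D : ℕ) {M k : ℕ} (hk : k ≤ M) :
    ∃ C : ℝ, 1 ≤ C ∧ ∀ l : List (Fin D), l.length = k →
      ∀ v : (Fin D → ℝ) → ℝ, ContDiff ℝ (⊤ : ℕ∞) v → TorusFun D v →
        invLpNorm (((k - 1 : ℕ) : ℝ) / (2 * (M - 1 : ℕ))) (pdIter l v) ≤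
          C * (WinfNorm 1 v ^ (1 - ((k - 1 : ℕ) : ℝ) / (M - 1 : ℕ)) *
            (WinfNorm 1 v + HdotNorm M v) ^ (((k - 1 : ℕ) : ℝ) / (M - 1 : ℕ))) := by
  rcases Nat.eq_zero_or_pos (k - 1) with hj | hj
  · refine ⟨1, le_rfl, fun l hl v hv hper => ?_⟩
    rw [hj, Nat.cast_zero, zero_div, zero_div, sub_zero, Real.rpow_zero, Real.rpow_one, mul_one,
      one_mul, winfNorm_one_eq]
    obtain rfl | rfl : k = 0 ∨ k = 1 := by omega
    · rw [List.length_eq_zero_iff.1 hl, invLpNorm, if_pos rfl]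
      exact le_add_of_nonneg_right (gradNorm_nonneg _ _ _)
    · exact (hl ▸ invLpNorm_pdIter_le_gradNorm 0 l v).trans
        (le_add_of_nonneg_left (linfNorm_nonneg v))
  · obtain ⟨j, rfl⟩ : ∃ j, k = j + 1 := ⟨k - 1, by omega⟩
    obtain ⟨n, rfl⟩ : ∃ n, M = n + 1 := ⟨M - 1, by omega⟩
    simp only [Nat.add_sub_cancel] at hj ⊢
    have hjn : j ≤ n := by omega
    have hn : 0 < n := by omega
    have hn' : (n : ℝ) ≠ 0 := Nat.cast_ne_zero.2 hn.ne'
    obtain ⟨K, hK, h⟩ := exists_gradNorm_pow_le D hn hjn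
    refine ⟨max 1 (K ^ (n : ℝ)⁻¹), le_max_left _ _, fun l hl v hv hper => ?_⟩
    have hW := winfNorm_nonneg 1 v
    have hH := hdotNorm_nonneg (n + 1) v
    have hG := gradNorm_nonneg ((j : ℝ) / (2 * n)) (j + 1) v
    calc invLpNorm ((j : ℝ) / (2 * n)) (pdIter l v)
        ≤ gradNorm ((j : ℝ) / (2 * n)) (j + 1) v := hl ▸ invLpNorm_pdIter_le_gradNorm _ l v
      _ = (gradNorm ((j : ℝ) / (2 * n)) (j + 1) v ^ n) ^ (n : ℝ)⁻¹ :=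
        (Real.pow_rpow_inv_natCast hG hn.ne').symm
      _ ≤ (K * (WinfNorm 1 v ^ (n - j) * HdotNorm (n + 1) v ^ j)) ^ (n : ℝ)⁻¹ :=
        Real.rpow_le_rpow (by positivity) (h v hv hper) (by positivity)
      _ = K ^ (n : ℝ)⁻¹ *
          (WinfNorm 1 v ^ (1 - (j : ℝ) / n) * HdotNorm (n + 1) v ^ ((j : ℝ) / n)) := by
        rw [Real.mul_rpow hK (by positivity), Real.mul_rpow (by positivity) (by positivity),
          ← Real.rpow_natCast_mul hW, ← Real.rpow_natCast_mul hH, Nat.cast_sub hjn,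
          ← div_eq_mul_inv, ← div_eq_mul_inv, sub_div, div_self hn']
      _ ≤ _ := by
        refine mul_le_mul (le_max_right _ _) (mul_le_mul_of_nonneg_left
          (Real.rpow_le_rpow hH (by linarith) (by positivity)) (by positivity))
          (by positivity) (by positivity)

lemma exists_invLpNorm_pdIter_le (D M : ℕ) :
    ∃ C : ℝ, 1 ≤ C ∧ ∀ l : List (Fin D), l.length ≤ M →
      ∀ v : (Fin D → ℝ) → ℝ, ContDiff ℝ (⊤ : ℕ∞) v → TorusFun D v →
        invLpNorm (((l.length - 1 : ℕ) : ℝ) / (2 * (M - 1 : ℕ))) (pdIter l v) ≤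
          C * (WinfNorm 1 v ^ (1 - ((l.length - 1 : ℕ) : ℝ) / (M - 1 : ℕ)) *
            (WinfNorm 1 v + HdotNorm M v) ^ (((l.length - 1 : ℕ) : ℝ) / (M - 1 : ℕ))) := by
  choose c hc1 hc using fun k : Fin (M + 1) =>
    exists_invLpNorm_pdIter_le_of_length_eq D (Nat.lt_succ_iff.1 k.2)
  have hle : ∀ k, c k ≤ ∑ k, c k := fun k =>
    Finset.single_le_sum (fun k _ => zero_le_one.trans (hc1 k)) (Finset.mem_univ k)
  refine ⟨∑ k, c k, (hc1 0).trans (hle 0), fun l hl v hv hper => ?_⟩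
  have hW := winfNorm_nonneg 1 v
  have hH := hdotNorm_nonneg M v
  exact (hc ⟨l.length, Nat.lt_succ_of_le hl⟩ l rfl v hv hper).trans
    (mul_le_mul_of_nonneg_right (hle _) (by positivity))

end Interpolation

section Product

lemma prod_rpow_mul_rpow_le {ι : Type*} [Fintype ι] [DecidableEq ι] [Nonempty ι] {W H θ : ι → ℝ}
    (hW : ∀ i, 0 < W i) (hWH : ∀ i, W i ≤ H i) (hθ : ∀ i, 0 ≤ θ i) (hθ1 : ∑ i, θ i ≤ 1) :
    ∏ i, W i ^ (1 - θ i) * H i ^ θ i ≤ ∑ i, H i * ∏ k ∈ Finset.univ.erase i, W k := by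
  have hH : ∀ i, 0 < H i := fun i => (hW i).trans_le (hWH i)
  have hy0 : ∀ i, 0 ≤ H i / W i := fun i => (div_pos (hH i) (hW i)).le
  have hle : ∀ i, H i / W i ≤ ∑ k, H k / W k := fun i =>
    Finset.single_le_sum (fun k _ => hy0 k) (Finset.mem_univ i)
  obtain ⟨i₀⟩ := ‹Nonempty ι›
  have hY1 : 1 ≤ ∑ k, H k / W k := ((one_le_div (hW i₀)).2 (hWH i₀)).trans (hle i₀)
  calc ∏ i, W i ^ (1 - θ i) * H i ^ θ i = ∏ i, W i * (H i / W i) ^ θ i := by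
        refine Finset.prod_congr rfl fun i _ => ?_
        rw [Real.rpow_sub (hW i), Real.rpow_one, Real.div_rpow (hH i).le (hW i).le]
        ring
    _ = (∏ i, W i) * ∏ i, (H i / W i) ^ θ i := Finset.prod_mul_distrib
    _ ≤ (∏ i, W i) * ∏ i, (∑ k, H k / W k) ^ θ i := by
        refine mul_le_mul_of_nonneg_left ?_ (Finset.prod_nonneg fun i _ => (hW i).le)
        exact Finset.prod_le_prod (fun i _ => Real.rpow_nonneg (hy0 i) _)
          fun i _ => Real.rpow_le_rpow (hy0 i) (hle i) (hθ i)
    _ ≤ (∏ i, W i) * ∑ k, H k / W k := by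
        refine mul_le_mul_of_nonneg_left ?_ (Finset.prod_nonneg fun i _ => (hW i).le)
        rw [← Real.rpow_sum_of_pos (by linarith)]
        simpa using Real.rpow_le_rpow_of_exponent_le hY1 hθ1
    _ = ∑ i, H i * ∏ k ∈ Finset.univ.erase i, W k := by
        rw [Finset.mul_sum]
        refine Finset.sum_congr rfl fun i _ => ?_
        rw [← Finset.mul_prod_erase _ _ (Finset.mem_univ i)]
        field_simp [(hW i).ne']

/-- If two of the orders `k i` are at least two, the loss of one derivative in each of them
makes the interpolation exponents summable to one even with `M - 1` in place of `M`. -/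
lemma sum_pred_div_pred_le_one {ι : Type*} [Fintype ι] {M : ℕ} {k m : ι → ℕ}
    (hk : ∑ i, k i = M) (hkm : ∀ i, k i ≤ m i) (hm : ∀ i, M - 1 ≤ m i) :
    ∑ i, ((k i - 1 : ℕ) : ℝ) / (m i - 1 : ℕ) ≤ 1 := by
  classical
  by_cases h : ∃ a b, a ≠ b ∧ 2 ≤ k a ∧ 2 ≤ k b
  · obtain ⟨a, b, hab, ha, hb⟩ := h
    have h1 : ∑ i, (k i - 1) + 2 ≤ M := by
      rw [← hk]
      calc ∑ i, (k i - 1) + 2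
          = ∑ i, ((k i - 1) + (if i = a then 1 else 0) + (if i = b then 1 else 0)) := by
            simp [Finset.sum_add_distrib]
        _ ≤ ∑ i, k i := by
            refine Finset.sum_le_sum fun i _ => ?_
            split_ifs with h1 h2 h2
            · exact absurd (h1.symm.trans h2) hab
            · subst h1; omega
            · subst h2; omega
            · omega
    have ha' : k a - 1 ≤ ∑ i, (k i - 1) :=
      Finset.single_le_sum (f := fun i => k i - 1) (fun _ _ => Nat.zero_le _) (Finset.mem_univ a)
    have hM : (0 : ℝ) < (M - 2 : ℕ) := Nat.cast_pos.2 (by omega)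
    calc ∑ i, ((k i - 1 : ℕ) : ℝ) / (m i - 1 : ℕ)
        ≤ ∑ i, ((k i - 1 : ℕ) : ℝ) / (M - 2 : ℕ) := by
          refine Finset.sum_le_sum fun i _ => ?_
          refine div_le_div_of_nonneg_left (Nat.cast_nonneg _) hM (Nat.cast_le.2 ?_)
          have := hm i
          omega
      _ = ((∑ i, (k i - 1) : ℕ) : ℝ) / (M - 2 : ℕ) := by
          rw [← Finset.sum_div, Nat.cast_sum]
      _ ≤ 1 := div_le_one_of_le₀ (Nat.cast_le.2 (by omega)) hM.le
  · push Not at h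
    by_cases h2 : ∃ a, 2 ≤ k a
    · obtain ⟨a, ha⟩ := h2
      rw [Finset.sum_eq_single a]
      · refine div_le_one_of_le₀ (Nat.cast_le.2 ?_) (Nat.cast_nonneg _)
        have := hkm a
        omega
      · intro b _ hb
        have := h a b hb.symm ha
        rw [show k b - 1 = 0 by omega, Nat.cast_zero, zero_div]
      · simp
    · push Not at h2
      rw [Finset.sum_eq_zero]
      · exact zero_le_one
      · intro b _
        have := h2 b
        rw [show k b - 1 = 0 by omega, Nat.cast_zero, zero_div]

lemma TorusFun.eq_zero_of_winfNorm_eq_zero {D : ℕ} {v : (Fin D → ℝ) → ℝ} (hv : TorusFun D v)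
    (hc : Continuous v) (h : WinfNorm 1 v = 0) : v = fun _ => 0 := by
  funext x
  rw [winfNorm_one_eq] at h
  have h1 := hv.abs_le_linfNorm hc x
  have h2 := gradNorm_nonneg 0 1 v
  exact abs_nonpos_iff.1 (by linarith)

end Product

/-- **Refined Sobolev product inequality on the torus** (paper's Lemma 4.1, inequality (4.4)):
with indices `r : Fin R` (zero-based), the "last `R₀` factors" are those with `R − R₀ ≤ r`,
and these are assumed to carry multi-indices of length at most `M₁ − 1`. -/
theorem stmt3 (D R R₀ M₁ : ℕ) (hD : 1 ≤ D) (hR : 1 ≤ R) (hM₁ : 1 ≤ M₁)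
    (hR₀ : 1 ≤ R₀) (hR₀R : R₀ ≤ R) :
    ∃ C : ℝ, 0 < C ∧ ∀ ι : Fin R → List (Fin D), (∑ r, (ι r).length) = M₁ →
      (∀ r : Fin R, R - R₀ ≤ (r : ℕ) → (ι r).length ≤ M₁ - 1) →
      ∀ v : Fin R → (Fin D → ℝ) → ℝ,
        (∀ r, ContDiff ℝ (⊤ : ℕ∞) (v r)) → (∀ r, TorusFun D (v r)) →
        L2norm (fun x => ∏ r, pdIter (ι r) (v r) x) ≤
          C * ((∑ r ∈ Finset.univ.filter (fun r : Fin R => (r : ℕ) < R - R₀),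
                  (WinfNorm 1 (v r) + HdotNorm M₁ (v r)) *
                    ∏ s ∈ Finset.univ.erase r, WinfNorm 1 (v s))
            + (∑ r ∈ Finset.univ.filter (fun r : Fin R => R - R₀ ≤ (r : ℕ)),
                  (WinfNorm 1 (v r) + HdotNorm (M₁ - 1) (v r)) *
                    ∏ s ∈ Finset.univ.erase r, WinfNorm 1 (v s))) := by
  classical
  have : Nonempty (Fin R) := ⟨⟨0, hR⟩⟩
  choose c hc1 hc using exists_invLpNorm_pdIter_le D
  set m : Fin R → ℕ := fun r => if (r : ℕ) < R - R₀ then M₁ else M₁ - 1 with hm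
  set B := max (c M₁) (c (M₁ - 1)) with hB
  have hB1 : 1 ≤ B := (hc1 M₁).trans (le_max_left _ _)
  have hcB : ∀ r, c (m r) ≤ B := by
    intro r
    simp only [hm]
    split_ifs
    exacts [le_max_left _ _, le_max_right _ _]
  refine ⟨B ^ R, by positivity, fun ι hι hι' v hv hper => ?_⟩
  have hsplit : ∀ f : ℕ → Fin R → ℝ,
      ∑ r ∈ Finset.univ.filter (fun r : Fin R => (r : ℕ) < R - R₀), f M₁ r +
        ∑ r ∈ Finset.univ.filter (fun r : Fin R => R - R₀ ≤ (r : ℕ)), f (M₁ - 1) r =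
      ∑ r, f (m r) r := by
    intro f
    rw [← Finset.sum_filter_add_sum_filter_not Finset.univ (fun r : Fin R => (r : ℕ) < R - R₀)]
    simp only [not_lt]
    congr 1
    · refine Finset.sum_congr rfl fun r hr => ?_
      simp only [hm, if_pos (Finset.mem_filter.1 hr).2]
    · refine Finset.sum_congr rfl fun r hr => ?_
      simp only [hm, if_neg (not_lt.2 (Finset.mem_filter.1 hr).2)]
  rw [hsplit fun M r => (WinfNorm 1 (v r) + HdotNorm M (v r)) *
    ∏ s ∈ Finset.univ.erase r, WinfNorm 1 (v s)]
  have hW : ∀ r, 0 ≤ WinfNorm 1 (v r) := fun r => winfNorm_nonneg 1 (v r)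
  have hH : ∀ r, 0 ≤ HdotNorm (m r) (v r) := fun r => hdotNorm_nonneg _ _
  by_cases h0 : ∃ r, WinfNorm 1 (v r) = 0
  · obtain ⟨r, hr⟩ := h0
    have hvr := (hper r).eq_zero_of_winfNorm_eq_zero (hv r).continuous hr
    have hzero : (fun x => ∏ r, pdIter (ι r) (v r) x) = fun _ => 0 := by
      funext x
      refine Finset.prod_eq_zero (Finset.mem_univ r) ?_
      rw [hvr, pdIter_zero]
    rw [hzero]
    have : L2norm (fun _ : Fin D → ℝ => (0 : ℝ)) = 0 := by simp [L2norm, L2sq]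
    rw [this]
    refine mul_nonneg (by positivity) (Finset.sum_nonneg fun r _ => ?_)
    exact mul_nonneg (add_nonneg (hW r) (hH r)) (Finset.prod_nonneg fun s _ => hW s)
  · push Not at h0
    have hkm : ∀ r, (ι r).length ≤ m r := by
      intro r
      simp only [hm]
      split_ifs with h
      · rw [← hι]
        exact Finset.single_le_sum (f := fun r => (ι r).length) (fun _ _ => Nat.zero_le _)
          (Finset.mem_univ r)
      · exact hι' r (not_lt.1 h)
    have hθ1 := sum_pred_div_pred_le_one hι hkm fun r => by
      simp only [hm]; split_ifs <;> omega
    calc L2norm (fun x => ∏ r, pdIter (ι r) (v r) x)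
        ≤ ∏ r, invLpNorm ((((ι r).length - 1 : ℕ) : ℝ) / (2 * (m r - 1 : ℕ)))
            (pdIter (ι r) (v r)) := by
          refine l2Norm_prod_le (fun r => ((hv r).pdIter _).continuous)
            (fun r => (hper r).pdIter _) (fun r => by positivity) (le_of_eq_of_le ?_ hθ1)
          refine Finset.sum_congr rfl fun r _ => ?_
          rw [← mul_div_assoc, mul_div_mul_left _ _ two_ne_zero]
      _ ≤ ∏ r, B * (WinfNorm 1 (v r) ^ (1 - (((ι r).length - 1 : ℕ) : ℝ) / (m r - 1 : ℕ)) *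
            (WinfNorm 1 (v r) + HdotNorm (m r) (v r)) ^
              ((((ι r).length - 1 : ℕ) : ℝ) / (m r - 1 : ℕ))) := by
          refine Finset.prod_le_prod (fun r _ => invLpNorm_nonneg _ _) fun r _ => ?_
          refine (hc (m r) (ι r) (hkm r) (v r) (hv r) (hper r)).trans
            (mul_le_mul_of_nonneg_right (hcB r) ?_)
          exact mul_nonneg (Real.rpow_nonneg (hW r) _)
            (Real.rpow_nonneg (add_nonneg (hW r) (hH r)) _)
      _ = B ^ R * ∏ r, WinfNorm 1 (v r) ^ (1 - (((ι r).length - 1 : ℕ) : ℝ) / (m r - 1 : ℕ)) *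
            (WinfNorm 1 (v r) + HdotNorm (m r) (v r)) ^
              ((((ι r).length - 1 : ℕ) : ℝ) / (m r - 1 : ℕ)) := by
          rw [Finset.prod_mul_distrib, Finset.prod_const, Finset.card_univ, Fintype.card_fin]
      _ ≤ _ := by
          refine mul_le_mul_of_nonneg_left (prod_rpow_mul_rpow_le
            (fun r => (hW r).lt_of_ne' (h0 r)) (fun r => by linarith [hH r])
            (fun r => by positivity) hθ1) (by positivity)
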